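/- For all natural numbers n and k with 0 ≤ k ≤ n, the following identity of polynomials in q holds: (1-q)^{n-k} · Σ_{π ∈ Π_n, |π|=k} q^{cro(π)} = Σ_{j=0}^{k} Σ_{i=j}^{n-k} (-1)^i · (C(n,k+i)·C(n,k-j) - C(n,k+i+1)·C(n,k-j-1)) · [i choose j]_q · q^{j(j+1)/2}, where C(·,·) is the binomial coefficient (zero on negative arguments) and [i choose j]_q is the Gaussian (q-)binomial coefficient. -/

import Mathlib

open Finset

inductive Step : Type
  | U | L | D
deriving DecidableEq

instance : Fintype Step where
  elems := ⟨([.U, .L, .D] : List Step), by decide⟩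
  complete := by intro x; cases x <;> decide

/-- The vertical displacement of a step: up = +1, level = 0, down = -1. -/
def Step.val : Step → ℤ
  | .U => 1
  | .L => 0
  | .D => -1

/-- The partial sum of the step values of the first `i` steps;
this is the height at which step `i` starts. -/
def hsum {n : ℕ} (P : Fin n → Step) (i : ℕ) : ℤ :=
  ∑ j ∈ Finset.univ.filter (fun j : Fin n => (j : ℕ) < i), (P j).val

/-- A Motzkin path: all partial sums nonnegative and total sum 0. -/
abbrev IsMotzkin {n : ℕ} (P : Fin n → Step) : Prop :=
  (∀ i : Fin (n+1), 0 ≤ hsum P (i : ℕ)) ∧ hsum P n = 0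

/-- A Motzkin prefix of final height `k`: all partial sums nonnegative, total sum `k`. -/
abbrev IsMPrefix {n : ℕ} (P : Fin n → Step) (k : ℕ) : Prop :=
  (∀ i : Fin (n+1), 0 ≤ hsum P (i : ℕ)) ∧ hsum P n = (k : ℤ)

/-- `[h]_q = 1 + q + ... + q^(h-1)`. -/
def geo {R : Type*} [CommSemiring R] (q : R) (h : ℤ) : R :=
  ∑ i ∈ Finset.range h.toNat, q ^ i

/-- The Gaussian (q-)binomial coefficient, via the q-Pascal recurrence. -/
def qbinom {R : Type*} [CommSemiring R] (q : R) : ℕ → ℕ → R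
  | _, 0 => 1
  | 0, _+1 => 0
  | n+1, k+1 => qbinom q n k + q ^ (k+1) * qbinom q n (k+1)

/-- The binomial coefficient with integer lower argument, zero on negative arguments. -/
def ch (m : ℕ) (j : ℤ) : ℤ := if 0 ≤ j then m.choose j.toNat else 0

/-- A set partition of `Fin n`, given as the finset of its blocks:
blocks are nonempty and every element lies in exactly one block. -/
abbrev IsPartition {n : ℕ} (P : Finset (Finset (Fin n))) : Prop :=
  (∀ B ∈ P, B.Nonempty) ∧ ∀ x : Fin n, (P.filter (fun B => x ∈ B)).card = 1

/-- `(a, b)` is an arc of the partition `P`: `a < b`, they lie in a common block,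
and no element of that block is strictly between them. -/
abbrev IsArc {n : ℕ} (P : Finset (Finset (Fin n))) (a b : Fin n) : Prop :=
  a < b ∧ ∃ B ∈ P, a ∈ B ∧ b ∈ B ∧ ∀ c ∈ B, ¬(a < c ∧ c < b)

/-- The number of crossings of a set partition: pairs of arcs `(i,j)`, `(k,l)`
with `i < k < j < l`. -/
def croP {n : ℕ} (P : Finset (Finset (Fin n))) : ℕ :=
  (Finset.univ.filter (fun x : (Fin n × Fin n) × (Fin n × Fin n) =>
    IsArc P x.1.1 x.1.2 ∧ IsArc P x.2.1 x.2.2 ∧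
    x.1.1 < x.2.1 ∧ x.2.1 < x.1.2 ∧ x.1.2 < x.2.2)).card

/-- The modified crossing number `cro*`: crossings, plus pairs of a block
maximum `m` and an arc `(k,l)` with `k < m < l`. -/
def croStar {n : ℕ} (P : Finset (Finset (Fin n))) : ℕ :=
  croP P +
  (Finset.univ.filter (fun x : Fin n × Fin n × Fin n =>
    (∃ B ∈ P, x.1 ∈ B ∧ ∀ y ∈ B, y ≤ x.1) ∧
    IsArc P x.2.1 x.2.2 ∧ x.2.1 < x.1 ∧ x.1 < x.2.2)).card


section QB
variable {R : Type*} [CommRing R] (q : R)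

theorem qb_zero (n : ℕ) : qbinom q n 0 = 1 := by cases n <;> simp [qbinom]

theorem qb_gt (n k : ℕ) (h : n < k) : qbinom q n k = 0 := by
  induction n generalizing k with
  | zero => cases k with
    | zero => omega
    | succ k => simp [qbinom]
  | succ n ih => cases k with
    | zero => omega
    | succ k => rw [qbinom, ih k (by omega), ih (k+1) (by omega)]; simp

theorem qb_self (n : ℕ) : qbinom q n n = 1 := by
  induction n with
  | zero => simp [qbinom]
  | succ n ih => rw [qbinom, ih, qb_gt q n (n+1) (by omega)]; simp

theorem qb_P2 (r j : ℕ) : qbinom q (r+j+1) (j+1) =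
    q^r * qbinom q (r+j) j + qbinom q (r+j) (j+1) := by
  induction h : r + j generalizing r j with
  | zero =>
    obtain rfl : r = 0 := by omega
    obtain rfl : j = 0 := by omega
    simp [qbinom]
  | succ n ih =>
    rcases r with _ | r
    · obtain rfl : j = n+1 := by omega
      rw [qb_self, qb_self, qb_gt q (n+1) (n+1+1) (by omega)]; simp
    rcases j with _ | j
    · have := ih r 0 (by omega)
      rw [qbinom, this]
      simp only [qb_zero, qbinom]
      have e2 := ih r 0 (by omega)
      simp only [qb_zero, qbinom] at e2
      linear_combination (q+1) * e2
    · have e1 := ih (r+1) j (by omega)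
      have e2 := ih r (j+1) (by omega)
      have d0 : qbinom q (n+1+1) (j+1+1) = qbinom q (n+1) (j+1) + q^(j+1+1) * qbinom q (n+1) (j+1+1) := by
        rw [qbinom]
      have d1 : qbinom q (n+1) (j+1) = qbinom q n (j) + q^(j+1) * qbinom q n (j+1) := by
        rw [qbinom]
      have d2 : qbinom q (n+1) (j+1+1) = qbinom q n (j+1) + q^(j+1+1) * qbinom q n (j+1+1) := by
        rw [qbinom]
      linear_combination d0 + e1 + q^(j+1+1) * e2 - d2 - q^(r+1) * d1

theorem qb_P5 (r j : ℕ) : (1 - q^r) * qbinom q (r+j) j = (1 - q^(j+1)) * qbinom q (r+j) (j+1) := by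
  have h := qb_P2 q r j
  rw [qbinom] at h
  linear_combination h

theorem qb_P3 (n k : ℕ) : (1 - q^(k+1)) * qbinom q (n+1) (k+1) = (1 - q^(n+1)) * qbinom q n k := by
  by_cases h : n < k
  · rw [qb_gt q _ _ h, qb_gt q (n+1) (k+1) (by omega)]; simp
  obtain ⟨r, rfl⟩ : ∃ r, n = r + k := ⟨n - k, by omega⟩
  have h1 := qb_P2 q r k
  have h2 := qb_P5 q r k
  linear_combination (1-q^(k+1)) * h1 - h2

theorem qb_P4 (r k : ℕ) : (1 - q^(r+1)) * qbinom q (r+1+k) k = (1 - q^(r+k+1)) * qbinom q (r+k) k := by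
  have h1 := qb_P5 q (r+1) k
  have h2 := qb_P3 q (r+k) k
  rw [show r+1+k = r+k+1 by ring] at *
  rw [h1, h2]

def Bf (r j h : ℕ) : R := (-1)^(r+j+h) * qbinom q (r+j) j * qbinom q r h * q^(j*(j+1)/2)

theorem tri (j : ℕ) : (j+1)*(j+1+1)/2 = j*(j+1)/2 + (j+1) := by
  rw [show (j+1)*(j+1+1) = j*(j+1) + (j+1)*2 by ring, Nat.add_mul_div_right _ _ (by norm_num)]

theorem Bf_a (r j h : ℕ) : Bf q (r+1) (j+1) (h+1) = Bf q r (j+1) h - q^(h+1) * Bf q r (j+1) (h+1)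
    + (1-q^(h+2)) * Bf q (r+2) j (h+2) - Bf q (r+1) j (h+1) := by
  have e1 : qbinom q (r+1+(j+1)) (j+1) = q^(r+1) * qbinom q (r+1+j) j + qbinom q (r+(j+1)) (j+1) := by
    have := qb_P2 q (r+1) j
    rw [show r + (j+1) = r+1+j by ring]; exact this
  have e2 : qbinom q (r+1) (h+1) = qbinom q r h + q^(h+1) * qbinom q r (h+1) := by rw [qbinom]
  have e3 := qb_P3 q (r+1) (h+1)
  have e4 := qb_P4 q (r+1) j
  simp only [Bf, tri]
  simp only [show r + 1 + 1 = r+2 by ring, show h + 1 + 1 = h + 2 by ring] at *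
  rw [e1, pow_add q (j*(j+1)/2)]
  generalize qbinom q (r+2+j) j = a at *
  generalize qbinom q (r+1+j) j = b at *
  generalize qbinom q (r+(j+1)) (j+1) = c at *
  generalize qbinom q (r+2) (h+2) = d at *
  generalize q^(j*(j+1)/2) = t at *
  generalize qbinom q (r+1) (h+1) = Q1 at *
  linear_combination (-((-1)^(r+j+h) * c * t * q^(j+1))) * e2 - ((-1)^(r+j+h) * t * a) * e3
    - ((-1)^(r+j+h) * t * Q1) * e4

theorem Bf_a0 (r j : ℕ) : Bf q (r+1) (j+1) 0 = - Bf q r (j+1) 0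
    + (1-q) * Bf q (r+2) j 1 - Bf q (r+1) j 0 := by
  have e1 : qbinom q (r+1+(j+1)) (j+1) = q^(r+1) * qbinom q (r+1+j) j + qbinom q (r+(j+1)) (j+1) := by
    have := qb_P2 q (r+1) j
    rw [show r + (j+1) = r+1+j by ring]; exact this
  have e3 := qb_P3 q (r+1) 0
  have e4 := qb_P4 q (r+1) j
  simp only [Bf, tri, qb_zero] at *
  simp only [show r + 1 + 1 = r+2 by ring, zero_add, pow_one] at *
  rw [e1, pow_add q (j*(j+1)/2)]
  generalize qbinom q (r+2+j) j = a at *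
  generalize qbinom q (r+1+j) j = b at *
  generalize qbinom q (r+(j+1)) (j+1) = c at *
  generalize qbinom q (r+2) 1 = d at *
  generalize q^(j*(j+1)/2) = t at *
  linear_combination - ((-1)^(r+j+1) * t * a) * (-1) * (-1) * e3
    - ((-1)^(r+j+1) * t) * e4

theorem Bf_b (r h : ℕ) : Bf q (r+1) 0 (h+1) = Bf q r 0 h - q^(h+1) * Bf q r 0 (h+1) := by
  simp only [Bf, qbinom, qb_zero]
  ring

theorem Bf_b0 (r : ℕ) : Bf q (r+1) 0 0 = - Bf q r 0 0 := by
  simp only [Bf, qb_zero]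
  ring

theorem Bf_c (j h : ℕ) : Bf q 0 (j+1) h = (1-q^(h+1)) * Bf q 1 j (h+1) - Bf q 0 j h := by
  rcases h with _ | h
  · have e4 := qb_P4 q 0 j
    have : qbinom q 1 1 = 1 := qb_self q 1
    simp only [Bf, zero_add, qb_self, qb_zero, tri, pow_one, this] at *
    linear_combination -((-1)^j * q^(j*(j+1)/2)) * e4
  · simp [Bf, qb_gt q 0 (h+1) (by omega), qb_gt q 1 (h+1+1) (by omega)]

open Polynomial

noncomputable def vsh (v : ℕ → R[X]) : ℕ → R[X]
  | 0 => 0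
  | h+1 => v h

noncomputable def Mop (v : ℕ → R[X]) (h : ℕ) : R[X] :=
  X * v h + vsh v h + X * (C (1-q^(h+1)) * v (h+1)) + C (1-q^h) * v h

noncomputable def Tt : ℕ → ℕ → R[X]
  | 0 => fun h => if h = 0 then 1 else 0
  | n+1 => Mop q (Tt n)

noncomputable def Wt : ℕ → ℕ → R[X]
  | 0 => fun h => if h = 0 then 1 else 0
  | 1 => fun h => Mop q (Wt 0) h - (1+X) * Wt 0 h
  | m+2 => fun h => Mop q (Wt (m+1)) h - (1+X) * Wt (m+1) h - X * Wt m h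

def Ac (m j h : ℕ) : R := if 2*j ≤ m then Bf q (m-2*j) j h else 0

theorem Wt_coeff (m : ℕ) : ∀ h j, (Wt q m h).coeff j = Ac q m j h := by
  induction m using Nat.strong_induction_on with
  | _ m ih =>
  intro h j
  match m, ih with
  | 0, ih =>
    rcases h with _ | h <;> rcases j with _ | j <;> simp [Wt, Ac, Bf, qb_zero, qb_gt, coeff_one]
  | 1, ih =>
    rcases h with _ | _ | h <;> rcases j with _ | j <;> 
      simp [Wt, Ac, Bf, qb_zero, qb_gt, coeff_one, Mop, vsh, qbinom, add_mul]
    all_goals (intro h; omega)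
  | m+2, ih =>
    have h1 := ih (m+1) (by omega)
    have h0 := ih m (by omega)
    simp only [Wt, Mop, coeff_add, coeff_sub, add_mul, one_mul, coeff_C_mul]
    rcases j with _ | j
    · simp only [coeff_X_mul_zero, h1, h0]
      rcases h with _ | h
      · simp [vsh, Ac, h1]
        have := Bf_b0 q (m+1)
        linear_combination -this
      · simp [vsh, Ac, h1]
        have := Bf_b q (m+1) h
        linear_combination -this
    · simp only [coeff_X_mul, coeff_C_mul, h1, h0]
      by_cases hj : 2 * j + 2 ≤ m + 1
      · obtain ⟨r, hr⟩ : ∃ r, m + 1 = r + (2 * j + 2) := ⟨m + 1 - (2*j+2), by omega⟩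
        have g1 : m + 2 - 2 * (j+1) = r + 1 := by omega
        have g2 : m + 1 - 2 * (j+1) = r := by omega
        have g3 : m - 2 * j = r + 1 := by omega
        have g4 : m + 1 - 2 * j = r + 2 := by omega
        have k1 : 2 * (j+1) ≤ m + 2 := by omega
        have k2 : 2 * (j+1) ≤ m + 1 := by omega
        have k3 : 2 * j ≤ m + 1 := by omega
        have k4 : 2 * j ≤ m := by omega
        rcases h with _ | h
        · simp only [vsh, Ac, g1, g2, g3, g4, k1, k2, k3, k4, if_true, coeff_zero]
          have := Bf_a0 q r j
          linear_combination -this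
        · simp only [vsh, h1, Ac, g1, g2, g3, g4, k1, k2, k3, k4, if_true]
          have := Bf_a q r j h
          linear_combination -this
      · by_cases hj2 : 2 * j = m
        · have g1 : m + 2 - 2 * (j+1) = 0 := by omega
          have g3 : m - 2 * j = 0 := by omega
          have g4 : m + 1 - 2 * j = 1 := by omega
          have k1 : 2 * (j+1) ≤ m + 2 := by omega
          have k2 : ¬ 2 * (j+1) ≤ m + 1 := by omega
          have k3 : 2 * j ≤ m + 1 := by omega
          have k4 : 2 * j ≤ m := by omega
          have := Bf_c q j h
          rcases h with _ | h
          · simp only [vsh, Ac, g1, g3, g4, k1, k2, k3, k4, if_true, if_false, coeff_zero]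
            linear_combination -this
          · simp only [vsh, h1, Ac, g1, g3, g4, k1, k2, k3, k4, if_true, if_false]
            linear_combination -this
        · have k1 : ¬ 2 * (j+1) ≤ m + 2 := by omega
          have k2 : ¬ 2 * (j+1) ≤ m + 1 := by omega
          have k4 : ¬ 2 * j ≤ m := by omega
          by_cases k3 : 2 * j ≤ m + 1
          · have g4 : m + 1 - 2 * j = 0 := by omega
            rcases h with _ | h <;> simp [vsh, h1, Ac, k1, k2, k3, k4, g4, Bf, qb_gt]
          · rcases h with _ | h <;> simp [vsh, h1, Ac, k1, k2, k3, k4]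

theorem Mop_W (m h : ℕ) : Mop q (Wt q m) h = Wt q (m+1) h + (1+X) * Wt q m h +
    (if m = 0 then 0 else X * Wt q (m-1) h) := by
  rcases m with _ | m
  · simp [Wt]
  · simp [Wt]
    ring

noncomputable def cc : ℕ → ℕ → R[X]
  | 0 => fun m => if m = 0 then 1 else 0
  | n+1 => fun m => vsh (cc n) m + (1+X) * cc n m + X * cc n (m+1)

theorem cc_big (n : ℕ) : ∀ m, n < m → cc (R := R) n m = 0 := by
  induction n with
  | zero => intro m hm; simp [cc]; omega
  | succ n ih =>
    intro m hm
    rcases m with _ | m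
    · omega
    · simp [cc, vsh, ih m (by omega), ih (m+1) (by omega), ih (m+1+1) (by omega)]

theorem Mop_sum (N : ℕ) (c : ℕ → R[X]) (w : ℕ → ℕ → R[X]) (h : ℕ) :
    Mop q (fun h => ∑ m ∈ Finset.range N, c m * w m h) h =
      ∑ m ∈ Finset.range N, c m * Mop q (w m) h := by
  rcases h with _ | h
  · simp only [Mop, vsh, Finset.mul_sum, ← Finset.sum_add_distrib, add_zero]
    refine Finset.sum_congr rfl fun m _ => ?_
    ring
  · simp only [Mop, vsh, Finset.mul_sum, ← Finset.sum_add_distrib]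
    refine Finset.sum_congr rfl fun m _ => ?_
    ring

theorem Tt_eq (n : ℕ) : ∀ h, Tt q n h = ∑ m ∈ Finset.range (n+1), cc n m * Wt q m h := by
  induction n with
  | zero => intro h; simp [Tt, cc, Wt]
  | succ n ih =>
    intro h
    have e : Tt q n = fun h => ∑ m ∈ Finset.range (n+1), cc n m * Wt q m h := funext ih
    rw [Tt, e, Mop_sum]
    simp only [Mop_W, mul_add]
    rw [Finset.sum_add_distrib, Finset.sum_add_distrib]
    have s1 : ∑ m ∈ Finset.range (n+1+1), vsh (cc n) m * Wt q m h =
        ∑ m ∈ Finset.range (n+1), cc n m * Wt q (m+1) h := by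
      rw [Finset.sum_range_succ']; simp [vsh]
    have s2 : ∑ m ∈ Finset.range (n+1+1), cc n m * ((1+X) * Wt q m h) =
        ∑ m ∈ Finset.range (n+1), cc n m * ((1+X) * Wt q m h) := by
      rw [Finset.sum_range_succ, cc_big n (n+1) (by omega)]; simp
    have s3 : ∑ m ∈ Finset.range (n+1+1), X * cc n (m+1) * Wt q m h =
        ∑ m ∈ Finset.range (n+1), cc n m * (if m = 0 then 0 else X * Wt q (m-1) h) := by
      rw [Finset.sum_range_succ, Finset.sum_range_succ, Finset.sum_range_succ',
        cc_big n (n+1) (by omega), cc_big n (n+1+1) (by omega)]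
      simp
      refine Finset.sum_congr rfl fun m _ => ?_
      ring
    rw [← s1, ← s2, ← s3, ← Finset.sum_add_distrib, ← Finset.sum_add_distrib]
    refine Finset.sum_congr rfl fun m _ => ?_
    simp only [cc]
    ring

theorem ch_nat (n m : ℕ) : ch n (m : ℤ) = n.choose m := by simp [ch]

theorem ch_neg (n : ℕ) (j : ℤ) (h : j < 0) : ch n j = 0 := by simp [ch, h]

theorem ch_succ (n : ℕ) (j : ℤ) : ch (n+1) j = ch n j + ch n (j-1) := by
  rcases lt_trichotomy j 0 with h | h | h
  · rw [ch_neg _ _ h, ch_neg _ _ h, ch_neg _ _ (by omega)]; simp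
  · subst h; simp [ch]
  · obtain ⟨m, rfl⟩ : ∃ m : ℕ, j = (m : ℤ) + 1 := ⟨(j-1).toNat, by omega⟩
    rw [add_sub_cancel_right, ch_nat, show (m : ℤ) + 1 = ((m+1 : ℕ) : ℤ) by simp, ch_nat, ch_nat,
      Nat.choose_succ_succ]
    push_cast; ring

theorem ch_zero (j : ℤ) : ch 0 j = if j = 0 then 1 else 0 := by
  rcases lt_trichotomy j 0 with h | h | h
  · rw [ch_neg _ _ h, if_neg (by omega)]
  · subst h; simp [ch]
  · obtain ⟨m, rfl⟩ : ∃ m : ℕ, j = (m : ℤ) + 1 := ⟨(j-1).toNat, by omega⟩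
    rw [show (m : ℤ) + 1 = ((m+1 : ℕ) : ℤ) by simp, ch_nat, if_neg (by omega)]; simp

theorem ch_big (n : ℕ) (j : ℤ) (h : (n : ℤ) < j) : ch n j = 0 := by
  obtain ⟨m, rfl⟩ : ∃ m : ℕ, j = (m : ℤ) := ⟨j.toNat, by omega⟩
  rw [ch_nat, Nat.choose_eq_zero_of_lt (by omega)]; simp

def gc (n : ℕ) (b m : ℤ) : ℤ := ch n (b+m) * ch n b - ch n (b+m+1) * ch n (b-1)

theorem gc_succ (n : ℕ) (b m : ℤ) : gc (n+1) b m = gc n b (m-1) + gc n b m + gc n (b-1) m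
    + gc n (b-1) (m+1) := by
  simp only [gc, ch_succ]
  ring_nf

theorem gc_m1 (n : ℕ) (b : ℤ) : gc n b (-1) = 0 := by
  simp only [gc]; ring_nf

theorem gc_bneg (n : ℕ) (b m : ℤ) (h : b < 0) : gc n b m = 0 := by
  simp [gc, ch_neg n b h, ch_neg n (b-1) (by omega)]

theorem cc_coeff (n : ℕ) : ∀ m b : ℕ, (cc (R := R) n m).coeff b = ((gc n b m : ℤ) : R) := by
  induction n with
  | zero =>
    intro m b
    rcases m with _ | m <;> rcases b with _ | b <;> simp [cc, gc, ch_zero, coeff_one]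
    all_goals grind
  | succ n ih =>
    intro m b
    rw [gc_succ]
    rcases m with _ | m <;> rcases b with _ | b <;> simp [cc, vsh, ih, add_mul, gc_m1, gc_bneg]
    all_goals ring_nf

theorem final_alg (n k : ℕ) (hk : k ≤ n) : (Tt q n 0).coeff k =
    ∑ j ∈ Finset.range (k+1), ∑ i ∈ Finset.Icc j (n-k),
        (-1 : R) ^ i *
          ((ch n ((k : ℤ) + i) * ch n ((k : ℤ) - j)
            - ch n ((k : ℤ) + i + 1) * ch n ((k : ℤ) - j - 1) : ℤ) : R) *
          qbinom q i j * q ^ (j * (j+1) / 2) := by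
  rw [Tt_eq, finset_sum_coeff]
  simp only [coeff_mul, Finset.Nat.sum_antidiagonal_eq_sum_range_succ_mk, cc_coeff, Wt_coeff]
  rw [Finset.sum_comm, ← Finset.sum_range_reflect]
  refine Finset.sum_congr rfl fun j hj => ?_
  have hj' : j ≤ k := by simpa [Nat.lt_succ_iff] using hj
  have e1 : k + 1 - 1 - j = k - j := by omega
  have e2 : k - (k - j) = j := by omega
  simp only [e1, e2]
  have key : ∀ i : ℕ, j ≤ i → (-1 : R) ^ i *
          ((ch n ((k : ℤ) + i) * ch n ((k : ℤ) - j)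
            - ch n ((k : ℤ) + i + 1) * ch n ((k : ℤ) - j - 1) : ℤ) : R) *
          qbinom q i j * q ^ (j * (j+1) / 2) =
          ((gc n ((k - j : ℕ) : ℤ) ((i + j : ℕ) : ℤ) : ℤ) : R) * Ac q (i+j) j 0 := by
    intro i hi
    have : i + j - 2 * j = i - j := by omega
    have h3 : i - j + j = i := by omega
    have h4 : 2 * j ≤ i + j := by omega
    simp only [Ac, h4, if_true, this, Bf, h3, gc, qb_zero]
    rw [show ((k - j : ℕ) : ℤ) = (k : ℤ) - j by omega]
    push_cast
    rw [show (k : ℤ) - j + (i + j) = k + i by ring]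
    simp
    ring
  symm
  refine Finset.sum_bij_ne_zero (fun i _ _ => i + j) ?_ ?_ ?_ ?_
  · intro i hi _
    simp at hi ⊢; omega
  · intro i _ _ i' _ _ h
    simpa using h
  · intro m hm hne
    have hm1 : 2 * j ≤ m := by
      by_contra hc
      apply hne; simp [Ac, hc]
    have hm2 : m - j ≤ n - k := by
      by_contra hc
      apply hne
      rw [gc, ch_big n (((k-j : ℕ) : ℤ) + m) (by omega), ch_big n (((k-j : ℕ) : ℤ) + m + 1) (by omega)]; simp
    refine ⟨m - j, by simp; omega, ?_, by omega⟩
    rw [key _ (by omega), show m - j + j = m by omega]; exact hne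
  · intro i hi _
    simp at hi
    exact key i hi.1

end QB

section Core
variable {R : Type*} [CommRing R] (q : R)

def cro2 (A : Finset (ℕ × ℕ)) : ℕ :=
  ((A ×ˢ A).filter (fun x => x.1.1 < x.2.1 ∧ x.2.1 < x.1.2 ∧ x.1.2 < x.2.2)).card

def cA (A : Finset (ℕ × ℕ)) (m : ℕ) : ℕ := (A.filter (fun x => x.1 < m ∧ m < x.2)).card

def Gs (h : ℕ) (A : Finset (ℕ × ℕ)) (Mx : Finset ℕ) : R :=
  ∑ S ∈ Mx.powersetCard h, q ^ (cro2 A + ∑ m ∈ S, cA A m)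

theorem Gs_insert_zero (A : Finset (ℕ × ℕ)) (Mx : Finset ℕ) (n : ℕ) :
    Gs q 0 A (insert n Mx) = Gs q 0 A Mx := by
  simp [Gs]

theorem Gs_insert_succ (h : ℕ) (A : Finset (ℕ × ℕ)) (Mx : Finset ℕ) (n : ℕ) (hn : n ∉ Mx)
    (hA : cA A n = 0) :
    Gs q (h+1) A (insert n Mx) = Gs q (h+1) A Mx + Gs q h A Mx := by
  unfold Gs
  rw [Finset.powersetCard_succ_insert hn, Finset.sum_union, Finset.sum_image]
  · congr 1
    refine Finset.sum_congr rfl fun S hS => ?_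
    rw [Finset.mem_powersetCard] at hS
    rw [Finset.sum_insert (fun h => hn (hS.1 h)), hA, zero_add]
  · intro S hS T hT hST
    rw [Finset.mem_coe, Finset.mem_powersetCard] at hS hT
    have h1 : n ∉ S := fun h => hn (hS.1 h)
    have h2 : n ∉ T := fun h => hn (hT.1 h)
    rw [← Finset.erase_insert h1, hST, Finset.erase_insert h2]
  · rw [Finset.disjoint_left]
    intro S hS hT
    rw [Finset.mem_image] at hT
    obtain ⟨T, _, rfl⟩ := hT
    rw [Finset.mem_powersetCard] at hS
    exact hn (hS.1 (Finset.mem_insert_self _ _))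

theorem cA_insert (A : Finset (ℕ × ℕ)) (m n m2 : ℕ) (hA : ∀ x ∈ A, x.1 < n ∧ x.2 < n) (h2 : m2 < n) :
    cA (insert (m,n) A) m2 = cA A m2 + if m < m2 then 1 else 0 := by
  have hmem : (m,n) ∉ A := fun h => by have := (hA _ h).2; simp at this
  unfold cA
  rw [Finset.filter_insert]
  split_ifs with h1 h3 h3
  · rw [Finset.card_insert_of_notMem (by simp [hmem])]
  · simp at h1; omega
  · simp at h1; omega
  · rfl

theorem cA_big (A : Finset (ℕ × ℕ)) (m n : ℕ) (hA : ∀ x ∈ A, x.1 < n ∧ x.2 < n) :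
    cA (insert (m,n) A) n = 0 := by
  unfold cA
  rw [Finset.card_eq_zero, Finset.filter_eq_empty_iff]
  intro x hx
  rw [Finset.mem_insert] at hx
  rcases hx with rfl | hx
  · simp
  · have := hA x hx; omega

theorem cA_big' (A : Finset (ℕ × ℕ)) (n : ℕ) (hA : ∀ x ∈ A, x.1 < n ∧ x.2 < n) :
    cA A n = 0 := by
  unfold cA
  rw [Finset.card_eq_zero, Finset.filter_eq_empty_iff]
  intro x hx
  have := hA x hx; omega

theorem cro_insert (A : Finset (ℕ × ℕ)) (m n : ℕ) (hA : ∀ x ∈ A, x.1 < n ∧ x.2 < n) :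
    cro2 (insert (m,n) A) = cro2 A + cA A m := by
  have hmem : (m,n) ∉ A := fun h => by have := (hA _ h).2; simp at this
  unfold cro2 cA
  have : ((insert (m,n) A) ×ˢ (insert (m,n) A)).filter
      (fun x => x.1.1 < x.2.1 ∧ x.2.1 < x.1.2 ∧ x.1.2 < x.2.2) =
      ((A ×ˢ A).filter (fun x => x.1.1 < x.2.1 ∧ x.2.1 < x.1.2 ∧ x.1.2 < x.2.2)) ∪
      (A.filter (fun x => x.1 < m ∧ m < x.2)).image (fun x => (x, (m,n))) := by
    ext ⟨x, y⟩
    simp only [Finset.mem_filter, Finset.mem_product, Finset.mem_insert, Finset.mem_union,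
      Finset.mem_image, Prod.mk.injEq]
    constructor
    · rintro ⟨⟨hx, hy⟩, h1, h2, h3⟩
      rcases hx with rfl | hx
      · rcases hy with rfl | hy
        · simp at h1
        · have := hA _ hy; simp at h3; omega
      · rcases hy with rfl | hy
        · right; exact ⟨x, ⟨hx, h1, h2⟩, rfl, rfl⟩
        · left; exact ⟨⟨hx, hy⟩, h1, h2, h3⟩
    · rintro (⟨⟨hx, hy⟩, h⟩ | ⟨z, ⟨hz, h1, h2⟩, rfl, rfl⟩)
      · exact ⟨⟨Or.inr hx, Or.inr hy⟩, h⟩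
      · exact ⟨⟨Or.inr hz, Or.inl rfl⟩, h1, h2, (hA _ hz).2⟩
  rw [this, Finset.card_union_of_disjoint, Finset.card_image_of_injective]
  · intro x y h; simpa using h
  · rw [Finset.disjoint_left]
    rintro ⟨x, y⟩ h1 h2
    simp only [Finset.mem_filter, Finset.mem_product, Finset.mem_image, Prod.mk.injEq] at h1 h2
    obtain ⟨z, _, _, rfl⟩ := h2
    exact hmem h1.1.2

theorem sum_rank (S : Finset ℕ) :
    ∑ m ∈ S, q ^ ((S.filter (fun x => m < x)).card) = ∑ i ∈ Finset.range S.card, q ^ i := by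
  induction S using Finset.induction_on_max with
  | empty => simp
  | insert a s ha ih =>
    have hna : a ∉ s := fun h => lt_irrefl _ (ha a h)
    rw [Finset.sum_insert hna, Finset.card_insert_of_notMem hna, geom_sum_succ, ← ih, Finset.mul_sum,
      add_comm]
    congr 1
    · refine Finset.sum_congr rfl fun m hm => ?_
      rw [Finset.filter_insert, if_pos (ha m hm), Finset.card_insert_of_notMem (by simp [hna]), pow_succ']
    · have : (insert a s).filter (fun x => a < x) = ∅ := by
        rw [Finset.filter_eq_empty_iff]
        intro x hx
        rw [Finset.mem_insert] at hx
        rcases hx with rfl | hx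
        · simp
        · have := ha x hx; omega
      rw [this]; simp

theorem sum_exch (Mx : Finset ℕ) (h : ℕ) (g : ℕ → Finset ℕ → R) :
    ∑ m ∈ Mx, ∑ S ∈ (Mx.erase m).powersetCard h, g m S =
      ∑ S ∈ Mx.powersetCard (h+1), ∑ m ∈ S, g m (S.erase m) := by
  rw [Finset.sum_sigma', Finset.sum_sigma']
  refine Finset.sum_bij' (fun x _ => ⟨insert x.1 x.2, x.1⟩) (fun x _ => ⟨x.2, x.1.erase x.2⟩) ?_ ?_ ?_ ?_ ?_
  · rintro ⟨m, S⟩ hx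
    simp only [Finset.mem_sigma, Finset.mem_powersetCard] at hx ⊢
    obtain ⟨hm, hS, hc⟩ := hx
    have hmS : m ∉ S := fun h => by simpa using hS h
    refine ⟨⟨?_, ?_⟩, Finset.mem_insert_self _ _⟩
    · exact Finset.insert_subset hm (hS.trans (Finset.erase_subset _ _))
    · rw [Finset.card_insert_of_notMem hmS, hc]
  · rintro ⟨S, m⟩ hx
    simp only [Finset.mem_sigma, Finset.mem_powersetCard] at hx ⊢
    obtain ⟨⟨hS, hc⟩, hm⟩ := hx
    refine ⟨hS hm, Finset.erase_subset_erase _ hS, ?_⟩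
    rw [Finset.card_erase_of_mem hm, hc]; rfl
  · rintro ⟨m, S⟩ hx
    simp only [Finset.mem_sigma, Finset.mem_powersetCard] at hx ⊢
    have hmS : m ∉ S := fun h => by simpa using hx.2.1 h
    rw [Finset.erase_insert hmS]
  · rintro ⟨S, m⟩ hx
    simp only [Finset.mem_sigma, Finset.mem_powersetCard] at hx ⊢
    rw [Finset.insert_erase hx.2]
  · rintro ⟨m, S⟩ hx
    simp only [Finset.mem_sigma, Finset.mem_powersetCard] at hx ⊢
    have hmS : m ∉ S := fun h => by simpa using hx.2.1 h
    rw [Finset.erase_insert hmS]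

theorem Gs_attach (h n : ℕ) (A : Finset (ℕ × ℕ)) (Mx : Finset ℕ)
    (hA : ∀ x ∈ A, x.1 < n ∧ x.2 < n) (hM : ∀ x ∈ Mx, x < n) :
    ∑ m ∈ Mx, Gs q h (insert (m,n) A) (Mx.erase m) =
      (∑ i ∈ Finset.range (h+1), q^i) * Gs q (h+1) A Mx := by
  unfold Gs
  rw [sum_exch, Finset.mul_sum]
  refine Finset.sum_congr rfl fun S hS => ?_
  rw [Finset.mem_powersetCard] at hS
  rw [← hS.2, ← sum_rank, Finset.sum_mul]
  refine Finset.sum_congr rfl fun m hm => ?_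
  rw [← pow_add, cro_insert A m n hA]
  congr 1
  have : ∑ x ∈ S.erase m, cA (insert (m,n) A) x =
      ∑ x ∈ S.erase m, cA A x + ∑ x ∈ S.erase m, if m < x then 1 else 0 := by
    rw [← Finset.sum_add_distrib]
    refine Finset.sum_congr rfl fun x hx => ?_
    rw [cA_insert A m n x hA (hM _ (hS.1 (Finset.mem_of_mem_erase hx)))]
  rw [this, ← Finset.add_sum_erase S _ hm, Finset.card_filter, ← Finset.add_sum_erase S _ hm]
  simp
  ring

theorem Gs_attach2_zero (n : ℕ) (A : Finset (ℕ × ℕ)) (Mx : Finset ℕ)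
    (hA : ∀ x ∈ A, x.1 < n ∧ x.2 < n) (hM : ∀ x ∈ Mx, x < n) :
    ∑ m ∈ Mx, Gs q 0 (insert (m,n) A) (insert n (Mx.erase m)) = Gs q 1 A Mx := by
  simp only [Gs_insert_zero, Gs_attach q 0 n A Mx hA hM]
  simp

theorem Gs_attach2_succ (h n : ℕ) (A : Finset (ℕ × ℕ)) (Mx : Finset ℕ)
    (hA : ∀ x ∈ A, x.1 < n ∧ x.2 < n) (hM : ∀ x ∈ Mx, x < n) :
    ∑ m ∈ Mx, Gs q (h+1) (insert (m,n) A) (insert n (Mx.erase m)) =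
      (∑ i ∈ Finset.range (h+2), q^i) * Gs q (h+2) A Mx +
      (∑ i ∈ Finset.range (h+1), q^i) * Gs q (h+1) A Mx := by
  rw [← Gs_attach q (h+1) n A Mx hA hM, ← Gs_attach q h n A Mx hA hM, ← Finset.sum_add_distrib]
  refine Finset.sum_congr rfl fun m hm => ?_
  rw [Gs_insert_succ]
  · intro h
    exact lt_irrefl _ (hM _ (Finset.mem_of_mem_erase h))
  · exact cA_big A m n hA

end Core

section SPart

def IsP (n : ℕ) (P : Finset (Finset ℕ)) : Prop :=
  (∀ B ∈ P, B.Nonempty) ∧ (∀ B ∈ P, ∀ x ∈ B, x < n) ∧ (∀ x < n, ∃ B ∈ P, x ∈ B) ∧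
  (∀ B ∈ P, ∀ B' ∈ P, ∀ x, x ∈ B → x ∈ B' → B = B')

open Classical in
noncomputable def SPart (n : ℕ) : Finset (Finset (Finset ℕ)) :=
  (Finset.range n).powerset.powerset.filter (IsP n)

theorem mem_SPart (n : ℕ) (P : Finset (Finset ℕ)) : P ∈ SPart n ↔ IsP n P := by
  classical
  unfold SPart
  rw [Finset.mem_filter, and_iff_right_iff_imp]
  intro h
  rw [Finset.mem_powerset]
  intro B hB
  rw [Finset.mem_powerset]
  intro x hx
  exact Finset.mem_range.2 (h.2.1 B hB x hx)

def att (n : ℕ) (P : Finset (Finset ℕ)) (B : Finset ℕ) : Finset (Finset ℕ) :=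
  insert (insert n B) (P.erase B)

theorem IsP_insert (n : ℕ) (P) (h : IsP n P) : IsP (n+1) (insert {n} P) := by
  obtain ⟨h1, h2, h3, h4⟩ := h
  refine ⟨?_, ?_, ?_, ?_⟩
  · intro B hB
    rw [Finset.mem_insert] at hB
    rcases hB with rfl | hB
    · simp
    · exact h1 B hB
  · grind
  · intro x hx
    by_cases hxn : x = n
    · exact ⟨{n}, by simp, by simp [hxn]⟩
    · obtain ⟨B, hB, hxB⟩ := h3 x (by omega)
      exact ⟨B, by simp [hB], hxB⟩
  · grind

theorem IsP_erase (n : ℕ) (P) (h : IsP (n+1) P) (hn : {n} ∈ P) : IsP n (P.erase {n}) := by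
  obtain ⟨h1, h2, h3, h4⟩ := h
  refine ⟨?_, ?_, ?_, ?_⟩
  · grind
  · intro B hB x hx
    rw [Finset.mem_erase] at hB
    have := h2 B hB.2 x hx
    have : x ≠ n := by
      rintro rfl
      exact hB.1 (h4 _ hB.2 _ hn x hx (by simp))
    omega
  · intro x hx
    obtain ⟨B, hB, hxB⟩ := h3 x (by omega)
    refine ⟨B, ?_, hxB⟩
    rw [Finset.mem_erase]
    refine ⟨?_, hB⟩
    rintro rfl
    simp at hxB; omega
  · grind

theorem IsP_att (n : ℕ) (P) (B) (h : IsP n P) (hB : B ∈ P) : IsP (n+1) (att n P B) := by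
  obtain ⟨h1, h2, h3, h4⟩ := h
  unfold att
  refine ⟨?_, ?_, ?_, ?_⟩
  · grind
  · grind
  · intro x hx
    by_cases hxn : x = n
    · exact ⟨insert n B, by simp, by simp [hxn]⟩
    · obtain ⟨B', hB', hxB⟩ := h3 x (by omega)
      by_cases hBB : B' = B
      · exact ⟨insert n B, by simp, by simp [← hBB, hxB]⟩
      · exact ⟨B', by simp [hB', hBB], hxB⟩
  · grind

theorem IsP_notMem (n : ℕ) (P) (B) (h : IsP n P) (hB : B ∈ P) : n ∉ B := fun hn =>
  lt_irrefl _ (h.2.1 B hB n hn)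

theorem IsP_det (n : ℕ) (P) (B) (h : IsP (n+1) P) (hB : B ∈ P) (hn : n ∈ B) (hne : {n} ∉ P) :
    IsP n (insert (B.erase n) (P.erase B)) := by
  obtain ⟨h1, h2, h3, h4⟩ := h
  refine ⟨?_, ?_, ?_, ?_⟩
  · intro B' hB'
    rw [Finset.mem_insert] at hB'
    rcases hB' with rfl | hB'
    · by_contra hc
      rw [Finset.not_nonempty_iff_eq_empty] at hc
      apply hne
      rw [← Finset.insert_erase hn, hc] at hB
      simpa using hB
    · exact h1 _ (Finset.mem_of_mem_erase hB')
  · intro B' hB' x hx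
    rw [Finset.mem_insert] at hB'
    rcases hB' with rfl | hB'
    · have := h2 _ hB x (Finset.mem_of_mem_erase hx)
      have : x ≠ n := Finset.ne_of_mem_erase hx
      omega
    · have := h2 _ (Finset.mem_of_mem_erase hB') x hx
      have : x ≠ n := by
        rintro rfl
        exact Finset.ne_of_mem_erase hB' (h4 _ (Finset.mem_of_mem_erase hB') _ hB x hx hn)
      omega
  · intro x hx
    obtain ⟨B', hB', hxB⟩ := h3 x (by omega)
    by_cases hBB : B' = B
    · exact ⟨B.erase n, by simp, by subst hBB; simp [hxB]; omega⟩
    · exact ⟨B', by simp [hB', hBB], hxB⟩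
  · grind

def blk (n : ℕ) (P : Finset (Finset ℕ)) : Finset ℕ := (P.filter (fun B => n ∈ B)).sup id

theorem blk_eq (n : ℕ) (P) (B) (h : IsP (n+1) P) (hB : B ∈ P) (hn : n ∈ B) : blk n P = B := by
  have : P.filter (fun B => n ∈ B) = {B} := by
    ext B'
    simp only [Finset.mem_filter, Finset.mem_singleton]
    constructor
    · rintro ⟨h1, h2⟩
      exact h.2.2.2 _ h1 _ hB n h2 hn
    · rintro rfl; exact ⟨hB, hn⟩
  simp [blk, this]

theorem blk_spec (n : ℕ) (P) (h : IsP (n+1) P) : blk n P ∈ P ∧ n ∈ blk n P := by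
  obtain ⟨B, hB, hn⟩ := h.2.2.1 n (by omega)
  rw [blk_eq n P B h hB hn]
  exact ⟨hB, hn⟩

theorem singleton_notMem (n : ℕ) (P) (h : IsP n P) : {n} ∉ P := fun hh =>
  IsP_notMem n P _ h hh (by simp)

theorem ins_notMem (n : ℕ) (P) (B) (h : IsP n P) : insert n B ∉ P := fun hh =>
  IsP_notMem n P _ h hh (by simp)

theorem SPart_sum {M : Type*} [AddCommMonoid M] (n : ℕ) (f : Finset (Finset ℕ) → M) :
    ∑ P ∈ SPart (n+1), f P = ∑ P ∈ SPart n, (f (insert {n} P) + ∑ B ∈ P, f (att n P B)) := by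
  rw [Finset.sum_add_distrib, ← Finset.sum_filter_add_sum_filter_not (SPart (n+1)) (fun P => {n} ∈ P)]
  congr 1
  · refine Finset.sum_bij' (fun P _ => P.erase {n}) (fun P _ => insert {n} P) ?_ ?_ ?_ ?_ ?_
    · intro P hP
      rw [Finset.mem_filter, mem_SPart] at hP
      rw [mem_SPart]
      exact IsP_erase n P hP.1 hP.2
    · intro P hP
      rw [mem_SPart] at hP
      rw [Finset.mem_filter, mem_SPart]
      exact ⟨IsP_insert n P hP, by simp⟩
    · intro P hP
      rw [Finset.mem_filter] at hP
      exact Finset.insert_erase hP.2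
    · intro P hP
      rw [mem_SPart] at hP
      exact Finset.erase_insert (singleton_notMem n P hP)
    · intro P hP
      rw [Finset.mem_filter] at hP
      rw [Finset.insert_erase hP.2]
  · rw [Finset.sum_sigma']
    refine Finset.sum_bij' (fun P _ => ⟨insert ((blk n P).erase n) (P.erase (blk n P)), (blk n P).erase n⟩)
      (fun x _ => att n x.1 x.2) ?_ ?_ ?_ ?_ ?_
    · intro P hP
      rw [Finset.mem_filter, mem_SPart] at hP
      rw [Finset.mem_sigma, mem_SPart]
      have hb := blk_spec n P hP.1
      exact ⟨IsP_det n P _ hP.1 hb.1 hb.2 hP.2, by simp⟩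
    · rintro ⟨P, B⟩ hP
      rw [Finset.mem_sigma, mem_SPart] at hP
      rw [Finset.mem_filter, mem_SPart]
      refine ⟨IsP_att n P B hP.1 hP.2, ?_⟩
      simp only [att, Finset.mem_insert, Finset.mem_erase, not_or, not_and]
      refine ⟨?_, fun _ => singleton_notMem n P hP.1⟩
      intro he
      obtain ⟨x, hx⟩ := hP.1.1 B hP.2
      have h1 : x ∈ ({n} : Finset ℕ) := by rw [he]; simp [hx]
      have := hP.1.2.1 B hP.2 x hx
      simp at h1; omega
    · intro P hP
      rw [Finset.mem_filter, mem_SPart] at hP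
      have hb := blk_spec n P hP.1
      have hd := IsP_det n P _ hP.1 hb.1 hb.2 hP.2
      have : (blk n P).erase n ∉ P.erase (blk n P) := by
        intro hc
        obtain ⟨x, hx⟩ := hd.1 ((blk n P).erase n) (by simp)
        have h1 := Finset.mem_of_mem_erase hx
        have := hP.1.2.2.2 _ (Finset.mem_of_mem_erase hc) _ hb.1 x hx h1
        exact Finset.ne_of_mem_erase hc this
      simp only [att]
      rw [Finset.erase_insert this, Finset.insert_erase hb.2, Finset.insert_erase hb.1]
    · rintro ⟨P, B⟩ hP
      rw [Finset.mem_sigma, mem_SPart] at hP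
      have e : blk n (att n P B) = insert n B := blk_eq _ _ _ (IsP_att n P B hP.1 hP.2)
        (by simp [att]) (by simp)
      simp only [e]
      have e1 : (insert n B).erase n = B := Finset.erase_insert (IsP_notMem n P B hP.1 hP.2)
      have e2 : (att n P B).erase (insert n B) = P.erase B :=
        Finset.erase_insert (fun h => ins_notMem n P B hP.1 (Finset.mem_of_mem_erase h))
      rw [e1, e2, Finset.insert_erase hP.2]
    · intro P hP
      rw [Finset.mem_filter, mem_SPart] at hP
      have hb := blk_spec n P hP.1
      have hd := IsP_det n P _ hP.1 hb.1 hb.2 hP.2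
      have : (blk n P).erase n ∉ P.erase (blk n P) := by
        intro hc
        obtain ⟨x, hx⟩ := hd.1 ((blk n P).erase n) (by simp)
        have h1 := Finset.mem_of_mem_erase hx
        have := hP.1.2.2.2 _ (Finset.mem_of_mem_erase hc) _ hb.1 x hx h1
        exact Finset.ne_of_mem_erase hc this
      simp only [att]
      rw [Finset.erase_insert this, Finset.insert_erase hb.2, Finset.insert_erase hb.1]

def arcs (n : ℕ) (P : Finset (Finset ℕ)) : Finset (ℕ × ℕ) :=
  (Finset.range n ×ˢ Finset.range n).filter (fun x => x.1 < x.2 ∧ ∃ B ∈ P, x.1 ∈ B ∧ x.2 ∈ B ∧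
    ∀ c ∈ B, ¬ (x.1 < c ∧ c < x.2))

def maxes (n : ℕ) (P : Finset (Finset ℕ)) : Finset ℕ :=
  (Finset.range n).filter (fun m => ∃ B ∈ P, m ∈ B ∧ ∀ y ∈ B, y ≤ m)

theorem mem_arcs (n P a b) (h : IsP n P) : (a,b) ∈ arcs n P ↔ a < b ∧ ∃ B ∈ P, a ∈ B ∧ b ∈ B ∧
    ∀ c ∈ B, ¬ (a < c ∧ c < b) := by
  simp only [arcs, Finset.mem_filter, Finset.mem_product, Finset.mem_range, and_iff_right_iff_imp]
  rintro ⟨_, B, hB, h1, h2, _⟩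
  exact ⟨h.2.1 B hB _ h1, h.2.1 B hB _ h2⟩

theorem mem_maxes (n P m) (h : IsP n P) : m ∈ maxes n P ↔ ∃ B ∈ P, m ∈ B ∧ ∀ y ∈ B, y ≤ m := by
  simp only [maxes, Finset.mem_filter, Finset.mem_range, and_iff_right_iff_imp]
  rintro ⟨B, hB, h1, _⟩
  exact h.2.1 B hB _ h1

theorem arcs_insert (n P) (h : IsP n P) : arcs (n+1) (insert {n} P) = arcs n P := by
  ext ⟨a, b⟩
  rw [mem_arcs _ _ _ _ h, mem_arcs _ _ _ _ (IsP_insert n P h)]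
  obtain ⟨h1, h2, h3, h4⟩ := h
  constructor
  · rintro ⟨hab, B, hB, ha, hb, hc⟩
    rw [Finset.mem_insert] at hB
    rcases hB with rfl | hB
    · simp at ha hb; omega
    · exact ⟨hab, B, hB, ha, hb, hc⟩
  · rintro ⟨hab, B, hB, ha, hb, hc⟩
    exact ⟨hab, B, by simp [hB], ha, hb, hc⟩

theorem maxes_insert (n P) (h : IsP n P) : maxes (n+1) (insert {n} P) = insert n (maxes n P) := by
  ext m
  rw [Finset.mem_insert, mem_maxes _ _ _ h, mem_maxes _ _ _ (IsP_insert n P h)]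
  simp only [Finset.mem_insert, exists_eq_or_imp, Finset.mem_singleton, forall_eq]
  grind

theorem arcs_att (n P B m) (h : IsP n P) (hB : B ∈ P) (hm : m ∈ B) (hmax : ∀ y ∈ B, y ≤ m) :
    arcs (n+1) (att n P B) = insert (m,n) (arcs n P) := by
  ext ⟨a, b⟩
  rw [Finset.mem_insert, mem_arcs _ _ _ _ h, mem_arcs _ _ _ _ (IsP_att n P B h hB), Prod.mk.injEq]
  obtain ⟨h1, h2, h3, h4⟩ := h
  have hmn := h2 B hB m hm
  constructor
  · rintro ⟨hab, B', hB', ha, hb, hc⟩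
    rw [att, Finset.mem_insert, Finset.mem_erase] at hB'
    rcases hB' with rfl | ⟨_, hB'⟩
    · rw [Finset.mem_insert] at ha hb
      have hbn : ∀ x ∈ B, x < n := h2 B hB
      rcases ha with rfl | ha
      · rcases hb with rfl | hb
        · omega
        · have := hbn _ hb; omega
      · rcases hb with rfl | hb
        · left
          have h5 := hmax _ ha
          have h6 := hc m (by simp [hm])
          exact ⟨by omega, rfl⟩
        · right
          exact ⟨hab, B, hB, ha, hb, fun c hcB => hc c (by simp [hcB])⟩
    · right; exact ⟨hab, B', hB', ha, hb, hc⟩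
  · rintro (⟨rfl, rfl⟩ | ⟨hab, B', hB', ha, hb, hc⟩)
    · refine ⟨hmn, insert b B, by simp [att], by simp [hm], by simp, ?_⟩
      intro c hc
      rw [Finset.mem_insert] at hc
      rcases hc with rfl | hc
      · omega
      · have := hmax _ hc; omega
    · refine ⟨hab, ?_⟩
      by_cases hBB : B' = B
      · subst hBB
        refine ⟨insert n B', by simp [att], by simp [ha], by simp [hb], ?_⟩
        intro c hc'
        rw [Finset.mem_insert] at hc'
        rcases hc' with rfl | hc'
        · have := h2 _ hB _ hb; omega
        · exact hc c hc'
      · exact ⟨B', by simp [att, hBB, hB'], ha, hb, hc⟩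

theorem maxes_att (n P B m) (h : IsP n P) (hB : B ∈ P) (hm : m ∈ B) (hmax : ∀ y ∈ B, y ≤ m) :
    maxes (n+1) (att n P B) = insert n ((maxes n P).erase m) := by
  ext a
  rw [Finset.mem_insert, Finset.mem_erase, mem_maxes _ _ _ h, mem_maxes _ _ _ (IsP_att n P B h hB)]
  obtain ⟨h1, h2, h3, h4⟩ := h
  have hmn := h2 B hB m hm
  constructor
  · rintro ⟨B', hB', ha, hc⟩
    rw [att, Finset.mem_insert, Finset.mem_erase] at hB'
    rcases hB' with rfl | ⟨hne, hB'⟩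
    · left
      have := hc n (by simp)
      rw [Finset.mem_insert] at ha
      rcases ha with rfl | ha
      · rfl
      · have := h2 _ hB _ ha; omega
    · right
      refine ⟨?_, B', hB', ha, hc⟩
      rintro rfl
      exact hne (h4 _ hB' _ hB a ha hm)
  · rintro (rfl | ⟨hne, B', hB', ha, hc⟩)
    · refine ⟨insert a B, by simp [att], by simp, ?_⟩
      intro y hy
      rw [Finset.mem_insert] at hy
      rcases hy with rfl | hy
      · rfl
      · exact (h2 _ hB _ hy).le
    · refine ⟨B', ?_, ha, hc⟩
      have : B' ≠ B := by
        rintro rfl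
        have := hc _ hm
        have := hmax _ ha
        omega
      simp [att, this, hB']

theorem sum_blocks {M : Type*} [AddCommMonoid M] (n P) (h : IsP n P)
    (F : Finset (ℕ × ℕ) → Finset ℕ → M) :
    ∑ B ∈ P, F (arcs (n+1) (att n P B)) (maxes (n+1) (att n P B)) =
      ∑ m ∈ maxes n P, F (insert (m,n) (arcs n P)) (insert n ((maxes n P).erase m)) := by
  refine Finset.sum_bij (fun B hB => B.max' (h.1 B hB)) ?_ ?_ ?_ ?_
  · intro B hB
    rw [mem_maxes _ _ _ h]
    exact ⟨B, hB, B.max'_mem _, fun y hy => B.le_max' y hy⟩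
  · intro B hB B' hB' he
    have h1 := B.max'_mem (h.1 B hB)
    have h2 := B'.max'_mem (h.1 B' hB')
    rw [← he] at h2
    exact h.2.2.2 _ hB _ hB' _ h1 h2
  · intro m hm
    rw [mem_maxes _ _ _ h] at hm
    obtain ⟨B, hB, hm, hx⟩ := hm
    refine ⟨B, hB, le_antisymm (hx _ (B.max'_mem _)) (B.le_max' _ hm)⟩
  · intro B hB
    rw [arcs_att n P B _ h hB (B.max'_mem (h.1 B hB)) (fun y hy => B.le_max' y hy),
      maxes_att n P B _ h hB (B.max'_mem (h.1 B hB)) (fun y hy => B.le_max' y hy)]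

theorem card_ins (n P) (h : IsP n P) : (insert {n} P).card = P.card + 1 :=
  Finset.card_insert_of_notMem (singleton_notMem n P h)

theorem card_att (n P B) (h : IsP n P) (hB : B ∈ P) : (att n P B).card = P.card := by
  rw [att, Finset.card_insert_of_notMem (fun hh => ins_notMem n P B h (Finset.mem_of_mem_erase hh)),
    Finset.card_erase_add_one hB]

theorem card_le (n P) (h : IsP n P) : P.card ≤ n := by
  have : P.card ≤ (Finset.range n).card := by
    refine Finset.card_le_card_of_forall_subsingleton (fun B x => x ∈ B) ?_ ?_
    · intro B hB
      obtain ⟨x, hx⟩ := h.1 B hB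
      exact ⟨x, by simpa using h.2.1 B hB x hx, hx⟩
    · intro x _ B hB B' hB'
      exact h.2.2.2 _ hB.1 _ hB'.1 x hB.2 hB'.2
  simpa using this

end SPart

section Fin
variable {R : Type*} [CommRing R] (q : R)
open Polynomial

noncomputable def Fw (n h k : ℕ) (A : Finset (ℕ × ℕ)) (Mx : Finset ℕ) : R[X] :=
  X^k * (C (1-q)^(n-k) * Gs (C q) h A Mx)

noncomputable def Zs (n h : ℕ) : R[X] := ∑ P ∈ SPart n, Fw q n h P.card (arcs n P) (maxes n P)

theorem arcs_lt (n P) : ∀ x ∈ arcs n P, x.1 < n ∧ x.2 < n := by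
  intro x hx
  simp only [arcs, Finset.mem_filter, Finset.mem_product, Finset.mem_range] at hx
  exact hx.1

theorem maxes_lt (n P) : ∀ x ∈ maxes n P, x < n := by
  intro x hx
  simp only [maxes, Finset.mem_filter, Finset.mem_range] at hx
  exact hx.1

theorem geoC (h : ℕ) : C (1-q) * ∑ i ∈ Finset.range h, (C q)^i = (C (1-q^h) : R[X]) := by
  have := mul_neg_geom_sum (C q : R[X]) h
  simpa using this

theorem Zs_step (n h : ℕ) : Zs q (n+1) h = ∑ P ∈ SPart n,
    (X^(P.card+1) * (C (1-q)^(n-P.card) * Gs (C q) h (arcs n P) (insert n (maxes n P))) +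
     X^(P.card) * (C (1-q)^(n-P.card) * (C (1-q) * ∑ m ∈ maxes n P,
        Gs (C q) h (insert (m,n) (arcs n P)) (insert n ((maxes n P).erase m))))) := by
  rw [Zs, SPart_sum]
  refine Finset.sum_congr rfl fun P hP => ?_
  rw [mem_SPart] at hP
  congr 1
  · rw [card_ins n P hP, arcs_insert n P hP, maxes_insert n P hP, Fw, Nat.add_sub_add_right]
  · have e : ∑ B ∈ P, Fw q (n+1) h (att n P B).card (arcs (n+1) (att n P B)) (maxes (n+1) (att n P B))
        = ∑ B ∈ P, Fw q (n+1) h P.card (arcs (n+1) (att n P B)) (maxes (n+1) (att n P B)) :=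
      Finset.sum_congr rfl fun B hB => by rw [card_att n P B hP hB]
    rw [e, sum_blocks n P hP (fun A M => Fw q (n+1) h P.card A M)]
    have := card_le n P hP
    simp only [Fw, Finset.mul_sum]
    refine Finset.sum_congr rfl fun m _ => ?_
    rw [show n + 1 - P.card = n - P.card + 1 by omega]
    ring

theorem Zs_zero (n : ℕ) : Zs q (n+1) 0 = X * Zs q n 0 + C (1-q) * Zs q n 1 := by
  rw [Zs_step, Zs, Zs, Finset.mul_sum, Finset.mul_sum, ← Finset.sum_add_distrib]
  refine Finset.sum_congr rfl fun P hP => ?_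
  rw [Gs_insert_zero, Gs_attach2_zero _ _ _ _ (arcs_lt n P) (maxes_lt n P), Fw, Fw]
  ring

theorem Zs_succ (n h : ℕ) : Zs q (n+1) (h+1) = X * Zs q n (h+1) + X * Zs q n h
    + C (1-q^(h+2)) * Zs q n (h+2) + C (1-q^(h+1)) * Zs q n (h+1) := by
  rw [Zs_step, Zs, Zs, Zs, Finset.mul_sum, Finset.mul_sum, Finset.mul_sum, Finset.mul_sum,
    ← Finset.sum_add_distrib, ← Finset.sum_add_distrib, ← Finset.sum_add_distrib]
  refine Finset.sum_congr rfl fun P hP => ?_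
  rw [Gs_insert_succ _ _ _ _ _ (fun h => lt_irrefl _ (maxes_lt n P _ h)) (cA_big' _ _ (arcs_lt n P)),
    Gs_attach2_succ _ _ _ _ _ (arcs_lt n P) (maxes_lt n P), Fw, Fw, Fw, ← geoC, ← geoC]
  ring

theorem Zs_Tt (n : ℕ) : ∀ h, Zs q n h = X^h * Tt q n h := by
  induction n with
  | zero =>
    intro h
    have : SPart 0 = {∅} := by
      ext P
      rw [mem_SPart, Finset.mem_singleton]
      constructor
      · rintro ⟨h1, h2, _⟩
        rw [Finset.eq_empty_iff_forall_notMem]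
        intro B hB
        obtain ⟨x, hx⟩ := h1 B hB
        have := h2 B hB x hx
        omega
      · rintro rfl
        simp [IsP]
    rw [Zs, this]
    have e : ∀ h, (∅ : Finset ℕ).powersetCard (h+1) = ∅ := fun h => Finset.powersetCard_eq_empty.2 (by simp)
    rcases h with _ | h <;> simp [Fw, Gs, arcs, maxes, cro2, Tt, e]
  | succ n ih =>
    intro h
    rcases h with _ | h
    · rw [Zs_zero, ih, ih]; simp [Tt, Mop, vsh]; ring
    · rw [Zs_succ, ih, ih, ih]; simp only [Tt, Mop, vsh]; ring

theorem Zs_coeff (n k : ℕ) : (Zs q n 0).coeff k =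
    (1-q)^(n-k) * ∑ P ∈ (SPart n).filter (fun P => P.card = k), q ^ cro2 (arcs n P) := by
  rw [Zs, finset_sum_coeff, Finset.mul_sum, Finset.sum_filter]
  refine Finset.sum_congr rfl fun P _ => ?_
  simp only [Fw, Gs, Finset.powersetCard_zero, Finset.sum_singleton, Finset.sum_empty, add_zero]
  rw [← C_pow, ← C_pow, ← C_mul, mul_comm, coeff_C_mul, coeff_X_pow]
  by_cases h : P.card = k
  · simp [h]
  · simp [h, Ne.symm h]

end Fin

section Transfer

def up {n : ℕ} (P : Finset (Finset (Fin n))) : Finset (Finset ℕ) :=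
  P.map (Finset.mapEmbedding Fin.valEmbedding).toEmbedding

theorem mem_up {n : ℕ} (P : Finset (Finset (Fin n))) (B : Finset ℕ) :
    B ∈ up P ↔ ∃ B' ∈ P, B'.map Fin.valEmbedding = B := by
  simp [up, Finset.mapEmbedding_apply]

theorem IsPartition_iff {n : ℕ} (P : Finset (Finset (Fin n))) :
    IsPartition P ↔ IsP n (up P) := by
  constructor
  · rintro ⟨h1, h2⟩
    refine ⟨?_, ?_, ?_, ?_⟩
    · intro B hB
      obtain ⟨B', hB', rfl⟩ := (mem_up P B).1 hB
      simpa using h1 B' hB'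
    · intro B hB x hx
      obtain ⟨B', hB', rfl⟩ := (mem_up P B).1 hB
      rw [Finset.mem_map] at hx
      obtain ⟨y, _, rfl⟩ := hx
      exact y.2
    · intro x hx
      have := h2 ⟨x, hx⟩
      rw [Finset.card_eq_one] at this
      obtain ⟨B, hB⟩ := this
      have : B ∈ P.filter (fun B => (⟨x, hx⟩ : Fin n) ∈ B) := by rw [hB]; simp
      rw [Finset.mem_filter] at this
      refine ⟨B.map Fin.valEmbedding, (mem_up _ _).2 ⟨B, this.1, rfl⟩, ?_⟩
      rw [Finset.mem_map]
      exact ⟨_, this.2, rfl⟩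
    · intro B hB C hC x hxB hxC
      obtain ⟨B', hB', rfl⟩ := (mem_up P B).1 hB
      obtain ⟨C', hC', rfl⟩ := (mem_up P C).1 hC
      rw [Finset.mem_map] at hxB hxC
      obtain ⟨y, hy, rfl⟩ := hxB
      obtain ⟨z, hz, hzy⟩ := hxC
      obtain rfl : z = y := Fin.valEmbedding.injective hzy
      have := (Finset.card_eq_one.1 (h2 z))
      obtain ⟨D, hD⟩ := this
      have e1 : B' ∈ P.filter (fun B => z ∈ B) := by simp [hB', hy]
      have e2 : C' ∈ P.filter (fun B => z ∈ B) := by simp [hC', hz]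
      rw [hD, Finset.mem_singleton] at e1 e2
      rw [e1, e2]
  · rintro ⟨h1, h2, h3, h4⟩
    refine ⟨?_, ?_⟩
    · intro B hB
      simpa using h1 _ ((mem_up _ _).2 ⟨B, hB, rfl⟩)
    · intro x
      obtain ⟨B, hB, hx⟩ := h3 x x.2
      obtain ⟨B', hB', rfl⟩ := (mem_up P B).1 hB
      rw [Finset.card_eq_one]
      refine ⟨B', ?_⟩
      have hx' : x ∈ B' := by
        rw [Finset.mem_map] at hx
        obtain ⟨y, hy, hyx⟩ := hx
        obtain rfl : y = x := Fin.valEmbedding.injective hyx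
        exact hy
      ext C
      rw [Finset.mem_filter, Finset.mem_singleton]
      constructor
      · rintro ⟨hC, hxC⟩
        have := h4 _ ((mem_up _ _).2 ⟨C, hC, rfl⟩) _ hB x (Finset.mem_map.2 ⟨x, hxC, rfl⟩) hx
        exact Finset.map_injective _ this
      · rintro rfl; exact ⟨hB', hx'⟩

theorem isArc_iff {n : ℕ} (P : Finset (Finset (Fin n))) (a b : Fin n) :
    IsArc P a b ↔ ((a : ℕ), (b : ℕ)) ∈ arcs n (up P) := by
  simp only [IsArc, arcs, Finset.mem_filter, Finset.mem_product, Finset.mem_range, a.2, b.2, true_and,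
    mem_up, exists_exists_and_eq_and, Fin.lt_def]
  refine and_congr_right fun _ => exists_congr fun B => ?_
  have hm : ∀ x : Fin n, (x : ℕ) ∈ B.map Fin.valEmbedding ↔ x ∈ B := fun x =>
    Finset.mem_map' Fin.valEmbedding
  rw [hm, hm]
  simp

theorem cro_up {n : ℕ} (P : Finset (Finset (Fin n))) : croP P = cro2 (arcs n (up P)) := by
  unfold croP cro2
  refine Finset.card_bij (fun x _ => (((x.1.1 : ℕ), (x.1.2 : ℕ)), ((x.2.1 : ℕ), (x.2.2 : ℕ)))) ?_ ?_ ?_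
  · rintro ⟨⟨a, b⟩, ⟨c, d⟩⟩ hx
    simp only [Finset.mem_filter, Finset.mem_univ, true_and, isArc_iff, Finset.mem_product, Fin.lt_def] at hx ⊢
    exact ⟨⟨hx.1, hx.2.1⟩, hx.2.2⟩
  · rintro ⟨⟨a, b⟩, ⟨c, d⟩⟩ _ ⟨⟨a', b'⟩, ⟨c', d'⟩⟩ _ h
    simp only [Prod.mk.injEq] at h
    simp only [Prod.mk.injEq, Fin.ext_iff]
    exact h
  · rintro ⟨⟨a, b⟩, ⟨c, d⟩⟩ hx
    simp only [Finset.mem_filter, Finset.mem_product] at hx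
    have h1 := arcs_lt _ _ _ hx.1.1
    have h2 := arcs_lt _ _ _ hx.1.2
    refine ⟨((⟨a, h1.1⟩, ⟨b, h1.2⟩), (⟨c, h2.1⟩, ⟨d, h2.2⟩)), ?_, rfl⟩
    simp only [Finset.mem_filter, Finset.mem_univ, true_and, isArc_iff, Fin.lt_def]
    exact ⟨hx.1.1, hx.1.2, hx.2⟩

theorem transfer {R : Type*} [CommRing R] (q : R) (n k : ℕ) :
    ∑ P ∈ Finset.univ.filter
          (fun P : Finset (Finset (Fin n)) => IsPartition P ∧ P.card = k), q ^ croP P =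
    ∑ P ∈ (SPart n).filter (fun P => P.card = k), q ^ cro2 (arcs n P) := by
  refine Finset.sum_bij (fun P _ => up P) ?_ ?_ ?_ ?_
  · intro P hP
    rw [Finset.mem_filter] at hP ⊢
    rw [mem_SPart]
    refine ⟨(IsPartition_iff P).1 hP.2.1, ?_⟩
    rw [up, Finset.card_map]; exact hP.2.2
  · intro P _ P' _ h
    exact Finset.map_injective _ h
  · intro P hP
    rw [Finset.mem_filter, mem_SPart] at hP
    have hup : up (Finset.univ.filter (fun B : Finset (Fin n) => B.map Fin.valEmbedding ∈ P)) = P := by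
      ext B
      rw [mem_up]
      constructor
      · rintro ⟨B', hB', rfl⟩
        simpa using hB'
      · intro hB
        have e : (Finset.univ.filter (fun x : Fin n => (x : ℕ) ∈ B)).map Fin.valEmbedding = B := by
          ext x
          simp only [Finset.mem_map, Finset.mem_filter, Finset.mem_univ, true_and]
          constructor
          · rintro ⟨y, hy, rfl⟩; exact hy
          · intro hx
            exact ⟨⟨x, hP.1.2.1 B hB x hx⟩, hx, rfl⟩
        refine ⟨Finset.univ.filter (fun x : Fin n => (x : ℕ) ∈ B), ?_, e⟩
        rw [Finset.mem_filter, e]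
        exact ⟨Finset.mem_univ _, hB⟩
    refine ⟨_, ?_, hup⟩
    rw [Finset.mem_filter, IsPartition_iff, hup]
    refine ⟨Finset.mem_univ _, hP.1, ?_⟩
    rw [← hP.2]
    conv_rhs => rw [← hup, up, Finset.card_map]
  · intro P _
    rw [cro_up]

end Transfer

open Polynomial in
/-- Formula for the crossing generating function of set partitions of `{1,…,n}`
with `k` blocks. -/
theorem stmt1 (n k : ℕ) (hk : k ≤ n) :
    (1 - X) ^ (n - k) *
      ∑ P ∈ Finset.univ.filter
          (fun P : Finset (Finset (Fin n)) => IsPartition P ∧ P.card = k),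
        (X : Polynomial ℤ) ^ croP P
    = ∑ j ∈ Finset.range (k+1), ∑ i ∈ Finset.Icc j (n-k),
        (-1 : Polynomial ℤ) ^ i *
          ((ch n ((k : ℤ) + i) * ch n ((k : ℤ) - j)
            - ch n ((k : ℤ) + i + 1) * ch n ((k : ℤ) - j - 1) : ℤ) : Polynomial ℤ) *
          qbinom (X : Polynomial ℤ) i j * X ^ (j * (j+1) / 2) := by
  rw [transfer, ← Zs_coeff, Zs_Tt, pow_zero, one_mul, final_alg _ n k hk]
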